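/- arXiv:2603.07499 — 4 statements merged into one kernel-verified Lean document; each statement's English description precedes it below -/
import Mathlib

section
/- Let ψ be a real number with 0 ≤ ψ < 1. Then for every complex number z with Re(z) ≥ 0 and z ≠ 0, one has z − ψ·(1 − exp(−z)) ≠ 0; equivalently, 1 − ψ·(1 − exp(−z))/z ≠ 0. (This shows that the denominator factor appearing in the tire transfer functions hᵢ does not vanish on the punctured closed right half-plane.) -/
/-- On the closed right half-plane, `‖1 - exp (-z)‖ ≤ ‖z‖`. -/
theorem norm_one_sub_exp_neg_le {z : ℂ} (hz : 0 ≤ z.re) :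
    ‖1 - Complex.exp (-z)‖ ≤ ‖z‖ := by
  have hderiv : ∀ w ∈ {w : ℂ | 0 ≤ w.re},
      HasDerivWithinAt (fun w : ℂ => Complex.exp (-w)) (Complex.exp (-w) * -1)
        {w : ℂ | 0 ≤ w.re} w :=
    fun w _ => (hasDerivAt_neg w).cexp.hasDerivWithinAt
  have hbound : ∀ w ∈ {w : ℂ | 0 ≤ w.re}, ‖Complex.exp (-w) * -1‖ ≤ 1 := by
    intro w hw
    simpa [Complex.norm_exp] using hw
  have h := (convex_halfSpace_re_ge 0).norm_image_sub_le_of_norm_hasDerivWithin_le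
    hderiv hbound (x := z) (y := 0) hz (by simp)
  simpa using h


/-- For `ψ ∈ [0,1)` and complex `z ≠ 0` with `Re(z) ≥ 0`,
`z − ψ(1 − exp(−z)) ≠ 0`; equivalently `1 − ψ(1 − exp(−z))/z ≠ 0`. -/
theorem stmt_4 (ψ : ℝ) (hψ0 : 0 ≤ ψ) (hψ1 : ψ < 1) :
    ∀ z : ℂ, 0 ≤ z.re → z ≠ 0 →
      z - (ψ : ℂ) * (1 - Complex.exp (-z)) ≠ 0 ∧
      1 - (ψ : ℂ) * (1 - Complex.exp (-z)) / z ≠ 0 := by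
  intro z hz hz0
  have key : z - (ψ : ℂ) * (1 - Complex.exp (-z)) ≠ 0 := by
    intro h
    have hn : ‖z‖ = ψ * ‖1 - Complex.exp (-z)‖ := by
      conv_lhs => rw [sub_eq_zero.mp h]
      rw [norm_mul, Complex.norm_of_nonneg hψ0]
    have hle := mul_le_mul_of_nonneg_left (norm_one_sub_exp_neg_le hz) hψ0
    have hlt := mul_lt_of_lt_one_left (norm_pos_iff.mpr hz0) hψ1
    linarith
  refine ⟨key, fun h => key ?_⟩
  field_simp at h
  simpa using h
end

section
/- If z is a complex number with Re(z) ≥ 0 satisfying z + exp(−z) = 1, then z = 0. In other words, z = 0 is the only solution of z + exp(−z) − 1 = 0 in the closed right half-plane; every other complex solution has strictly negative real part. (This is the Lambert-W-function zero location argument of Lemma 3, stated without reference to the Lambert function.) -/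
/-- `z = 0` is the only solution of `z + exp(−z) = 1` in the closed right half-plane. -/
theorem stmt_5 : ∀ z : ℂ, 0 ≤ z.re → z + Complex.exp (-z) = 1 → z = 0 := by
  intro z hz h
  have hre : z.re + Real.exp (-z.re) * Real.cos z.im = 1 := by
    simpa [Complex.exp_re] using congrArg Complex.re h
  have him : z.im = Real.exp (-z.re) * Real.sin z.im := by
    have := congrArg Complex.im h
    simp only [Complex.add_im, Complex.exp_im, Complex.neg_re, Complex.neg_im, Real.sin_neg,
      Complex.one_im] at this
    linarith
  have hy : z.im = 0 := by
    by_contra hne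
    have hexp : Real.exp (-z.re) ≤ 1 := Real.exp_le_one_iff.2 (by linarith)
    have hpos := Real.exp_pos (-z.re)
    rcases lt_or_gt_of_ne hne with hlt | hgt
    · nlinarith [Real.lt_sin hlt]
    · nlinarith [Real.sin_lt hgt]
  have hx : z.re = 0 := by
    by_contra hne
    rw [hy, Real.cos_zero] at hre
    linarith [Real.add_one_lt_exp (neg_ne_zero.2 hne)]
  exact Complex.ext hx hy
end

section
/- Let λ > 0 and ψ ∈ [0,1) be real numbers, and for complex s ≠ 0 define h(s) = ((s/λ + exp(−s/λ) − 1)/(s²/λ)) · (1 − ψ·(1 − exp(−s/λ))/(s/λ))⁻¹. Then Re(h(s)) > 0 for every complex number s with Re(s) > 0. -/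
/-- A real function that is nonnegative at `0` and has positive derivative on `(0, ∞)` is positive
on `(0, ∞)`. -/
lemma pos_of_hasDerivAt_pos {f f' : ℝ → ℝ} (hf : ∀ x, HasDerivAt f (f' x) x) (h0 : 0 ≤ f 0)
    (hf' : ∀ x, 0 < x → 0 < f' x) {x : ℝ} (hx : 0 < x) : 0 < f x := by
  have hmono : StrictMonoOn f (Set.Ici 0) := by
    refine strictMonoOn_of_deriv_pos (convex_Ici 0)
      (fun y _ => (hf y).continuousAt.continuousWithinAt) fun y hy => ?_
    rw [interior_Ici] at hy
    rw [(hf y).deriv]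
    exact hf' y hy
  exact h0.trans_lt (hmono Set.self_mem_Ici hx.le hx)

lemma exp_mul_cubic_add_trig_pos (y : ℝ) {x : ℝ} (hx : 0 < x) :
    0 < Real.exp x * (x ^ 3 + x * y ^ 2 - x ^ 2 + y ^ 2)
      + ((x ^ 2 - y ^ 2) * Real.cos y - 2 * x * y * Real.sin y) := by
  have hcos := Real.one_sub_sq_div_two_le_cos (x := y)
  have hsin : y * Real.sin y ≤ y ^ 2 := by
    calc y * Real.sin y ≤ |y| * |Real.sin y| := by rw [← abs_mul]; exact le_abs_self _
      _ ≤ |y| * |y| := mul_le_mul_of_nonneg_left Real.abs_sin_le_abs (abs_nonneg y)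
      _ = y ^ 2 := by rw [abs_mul_abs_self, sq]
  have hpoly : ∀ a b c d t : ℝ, HasDerivAt (fun t : ℝ => a * t ^ 3 + b * t ^ 2 + c * t + d)
      (3 * a * t ^ 2 + 2 * b * t + c) t := fun a b c d t => by
    refine HasDerivAt.congr_deriv (((((hasDerivAt_pow 3 t).const_mul a).add ((hasDerivAt_pow 2 t).const_mul b)).add
      ((hasDerivAt_id t).const_mul c)).add_const d) ?_
    push_cast; ring
  have hD : ∀ a b c d p q r t : ℝ, HasDerivAt
      (fun t : ℝ => Real.exp t * (a * t ^ 3 + b * t ^ 2 + c * t + d)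
        + (0 * t ^ 3 + p * t ^ 2 + q * t + r))
      (Real.exp t * (a * t ^ 3 + (b + 3 * a) * t ^ 2 + (c + 2 * b) * t + (d + c))
        + (0 * t ^ 3 + 0 * t ^ 2 + 2 * p * t + q)) t := fun a b c d p q r t => by
    refine HasDerivAt.congr_deriv
      (((Real.hasDerivAt_exp t).mul (hpoly a b c d t)).add (hpoly 0 p q r t)) ?_
    ring
  have h2 : ∀ t : ℝ, 0 < t → _ := fun t ht =>
    pos_of_hasDerivAt_pos (x := t) (hD 1 5 (2 + y ^ 2) (3 * y ^ 2 - 2) 0 0 (2 * Real.cos y))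
      (by simp only [Real.exp_zero]; nlinarith [sq_nonneg y])
      (fun u hu => by
        have : 0 < u ^ 3 + 8 * u ^ 2 + (12 + y ^ 2) * u + 4 * y ^ 2 := by positivity
        have := mul_pos (Real.exp_pos u) this
        linarith) ht
  have h1 : ∀ t : ℝ, 0 < t → _ := fun t ht =>
    pos_of_hasDerivAt_pos (x := t)
      (hD 1 2 (y ^ 2 - 2) (2 * y ^ 2) 0 (2 * Real.cos y) (-2 * (y * Real.sin y)))
      (by simp only [Real.exp_zero]; linarith)
      (fun u hu => by linarith [h2 u hu]) ht
  have h0 := pos_of_hasDerivAt_pos (x := x)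
      (hD 1 (-1) (y ^ 2) (y ^ 2) (Real.cos y) (-2 * (y * Real.sin y)) (-y ^ 2 * Real.cos y))
      (by
        simp only [Real.exp_zero]
        nlinarith [mul_nonneg (sq_nonneg y) (sub_nonneg.2 (Real.cos_le_one y))])
      (fun u hu => by linarith [h1 u hu]) hx
  linarith

lemma re_add_exp_neg_sub_one_div_sq_pos {z : ℂ} (hz : 0 < z.re) :
    0 < ((z + Complex.exp (-z) - 1) / z ^ 2).re := by
  have hz0 : z ≠ 0 := fun h => by simp [h] at hz
  have key := mul_pos (Real.exp_pos (-z.re)) (exp_mul_cubic_add_trig_pos z.im hz)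
  have hE : Real.exp (-z.re) * Real.exp z.re = 1 := by rw [← Real.exp_add]; simp
  rw [mul_add, ← mul_assoc, hE, one_mul] at key
  have hn : 0 < Complex.normSq (z ^ 2) := Complex.normSq_pos.2 (pow_ne_zero 2 hz0)
  rw [Complex.div_re, ← add_div]
  refine div_pos ?_ hn
  simp only [sq, Complex.mul_re, Complex.mul_im, Complex.add_re, Complex.sub_re, Complex.add_im,
    Complex.sub_im, Complex.exp_re, Complex.exp_im, Complex.neg_re, Complex.neg_im,
    Complex.one_re, Complex.one_im, Real.cos_neg, Real.sin_neg]
  linarith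

lemma Complex.re_inv_pos {w : ℂ} (hw : 0 < w.re) : 0 < (w⁻¹).re := by
  have hw0 : w ≠ 0 := fun h => by simp [h] at hw
  rw [Complex.inv_re]
  exact div_pos hw (Complex.normSq_pos.2 hw0)

/-- For `λ > 0` and `ψ ∈ [0,1)`, the tire transfer function
`h(s) = ((s/λ + exp(−s/λ) − 1)/(s²/λ)) · (1 − ψ(1 − exp(−s/λ))/(s/λ))⁻¹`
has strictly positive real part on the open right half-plane. -/
theorem stmt_7 (lam ψ : ℝ) (hlam : 0 < lam) (hψ0 : 0 ≤ ψ) (hψ1 : ψ < 1)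
    (h : ℂ → ℂ)
    (hdef : ∀ s : ℂ, s ≠ 0 →
      h s = ((s / lam + Complex.exp (-(s / lam)) - 1) / (s ^ 2 / lam)) *
        (1 - (ψ : ℂ) * ((1 - Complex.exp (-(s / lam))) / (s / lam)))⁻¹) :
    ∀ s : ℂ, 0 < s.re → 0 < (h s).re := by
  intro s hs
  have hs0 : s ≠ 0 := fun h => by simp [h] at hs
  have hl : (lam : ℂ) ≠ 0 := by exact_mod_cast hlam.ne'
  rw [hdef s hs0]
  obtain ⟨z, rfl⟩ : ∃ z : ℂ, s = lam * z := ⟨s / lam, by field_simp⟩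
  rw [Complex.re_ofReal_mul] at hs
  have hz : 0 < z.re := pos_of_mul_pos_right hs hlam.le
  have hz0 : z ≠ 0 := right_ne_zero_of_mul hs0
  rw [mul_div_cancel_left₀ z hl]
  have hw := re_add_exp_neg_sub_one_div_sq_pos hz
  set w := (z + Complex.exp (-z) - 1) / z ^ 2 with hwdef
  have hw0 : w ≠ 0 := fun h => by simp [h] at hw
  have hnum : (z + Complex.exp (-z) - 1) / ((lam * z) ^ 2 / lam) = (lam : ℂ)⁻¹ * w := by
    rw [hwdef]; field_simp
  have hden : 1 - (ψ : ℂ) * ((1 - Complex.exp (-z)) / z)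
      = w * (((1 - ψ : ℝ) : ℂ) * w⁻¹ + ψ * z) := by
    have hzw : (1 - Complex.exp (-z)) / z = 1 - z * w := by
      rw [hwdef]; field_simp; ring
    rw [hzw]; push_cast; field_simp; ring
  rw [hnum, hden, mul_inv, mul_assoc, mul_inv_cancel_left₀ hw0, ← Complex.ofReal_inv,
    Complex.re_ofReal_mul]
  refine mul_pos (inv_pos.2 hlam) (Complex.re_inv_pos ?_)
  rw [Complex.add_re, Complex.re_ofReal_mul, Complex.re_ofReal_mul]
  exact add_pos_of_pos_of_nonneg (mul_pos (sub_pos.2 hψ1) (Complex.re_inv_pos hw))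
    (mul_nonneg hψ0 hz.le)
end

section
/- Let λ₁, λ₂ > 0 and ψ₁, ψ₂ ∈ [0,1) be real numbers, and for i ∈ {1,2} and complex s ≠ 0 define hᵢ(s) = ((s/λᵢ + exp(−s/λᵢ) − 1)/(s²/λᵢ)) · (1 − ψᵢ·(1 − exp(−s/λᵢ))/(s/λᵢ))⁻¹. Then for all real a₁, a₂ > 0 and every complex s with Re(s) ≥ 0 and s ≠ 0, one has a₁·h₁(s) + a₂·h₂(s) ≠ 0. (This is the scalar content of Lemma 3: the determinant of C(s), which equals a positive multiple of F_{z1}σ₁φ₁h₁(s) + F_{z2}σ₂φ₂h₂(s), has no zeros in the closed right half-plane, so C⁻¹(s) has no unstable poles.) -/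
theorem mul_sin_lt_sq {v : ℝ} (hv : v ≠ 0) : v * Real.sin v < v ^ 2 := by
  rcases lt_or_gt_of_ne hv with h | h
  · nlinarith [Real.lt_sin h]
  · nlinarith [Real.sin_lt h]

theorem re_one_sub_exp_neg_div_lt_one {z : ℂ} (hre : 0 ≤ z.re) (hz : z ≠ 0) :
    ((1 - Complex.exp (-z)) / z).re < 1 := by
  have hpos : 0 < Complex.normSq z := Complex.normSq_pos.mpr hz
  have hexp := Real.exp_pos (-z.re)
  have hmul : Real.exp (-z.re) * Real.exp z.re = 1 := by
    rw [← Real.exp_add]; simp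
  have key : z.re * (1 - Real.exp (-z.re) * Real.cos z.im) +
      z.im * (Real.exp (-z.re) * Real.sin z.im) < z.re ^ 2 + z.im ^ 2 := by
    have hcos : 1 - Real.cos z.im ≤ z.im ^ 2 / 2 := by
      linarith [Real.one_sub_sq_div_two_le_cos (x := z.im)]
    have hone : 1 - Real.exp (-z.re) ≤ z.re := by linarith [Real.add_one_le_exp (-z.re)]
    have hu : z.re * (1 - Real.exp (-z.re)) ≤ z.re ^ 2 := by
      nlinarith
    have hc : Real.exp (-z.re) * z.re * (1 - Real.cos z.im) ≤
        Real.exp (-z.re) * z.re * (z.im ^ 2 / 2) :=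
      mul_le_mul_of_nonneg_left hcos (by positivity)
    have hle : Real.exp (-z.re) * (1 + z.re / 2) ≤ 1 := by
      rw [← hmul]
      exact mul_le_mul_of_nonneg_left (by linarith [Real.add_one_le_exp z.re]) hexp.le
    have hq := mul_le_mul_of_nonneg_right hle (sq_nonneg z.im)
    by_cases hv : z.im = 0
    · have hu0 : z.re ≠ 0 := fun h => hz (Complex.ext h hv)
      have hupos : 0 < z.re := lt_of_le_of_ne hre hu0.symm
      have := Real.add_one_lt_exp (neg_ne_zero.mpr hu0)
      simp only [hv, Real.cos_zero, Real.sin_zero]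
      nlinarith
    · have := mul_lt_mul_of_pos_left (mul_sin_lt_sq hv) hexp
      linarith
  have hdiv : ((1 - Complex.exp (-z)) / z).re =
      (z.re * (1 - Real.exp (-z.re) * Real.cos z.im) +
      z.im * (Real.exp (-z.re) * Real.sin z.im)) / Complex.normSq z := by
    rw [Complex.div_re]
    simp [Complex.exp_re, Complex.exp_im]
    ring
  rw [hdiv, div_lt_one hpos, Complex.normSq_apply]
  linarith

theorem one_sub_div_one_sub_mul_re_pos {g : ℂ} {ψ : ℝ} (hψ0 : 0 ≤ ψ) (hψ1 : ψ < 1)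
    (hg : g.re < 1) : 0 < ((1 - g) * (1 - (ψ : ℂ) * g)⁻¹).re := by
  have hψg : 0 < 1 - ψ * g.re := by nlinarith
  have hne : 1 - (ψ : ℂ) * g ≠ 0 := fun h => by
    have := congrArg Complex.re h
    simp at this
    linarith
  have hpos : 0 < Complex.normSq (1 - (ψ : ℂ) * g) := Complex.normSq_pos.mpr hne
  have heq : ((1 - g) * (1 - (ψ : ℂ) * g)⁻¹).re =
      ((1 - g.re) * (1 - ψ * g.re) + ψ * g.im ^ 2) / Complex.normSq (1 - (ψ : ℂ) * g) := by
    simp only [Complex.mul_re, Complex.inv_re, Complex.inv_im, Complex.sub_re, Complex.sub_im,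
      Complex.one_re, Complex.one_im, Complex.mul_im, Complex.ofReal_re, Complex.ofReal_im]
    ring
  rw [heq]
  have := mul_pos (sub_pos.mpr hg) hψg
  positivity

theorem mul_tire_transfer_re_pos {lam ψ : ℝ} (hlam : 0 < lam) (hψ0 : 0 ≤ ψ) (hψ1 : ψ < 1)
    {s : ℂ} (hre : 0 ≤ s.re) (hs : s ≠ 0) :
    0 < (s * (((s / lam + Complex.exp (-(s / lam)) - 1) / (s ^ 2 / lam)) *
      (1 - (ψ : ℂ) * ((1 - Complex.exp (-(s / lam))) / (s / lam)))⁻¹)).re := by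
  have hl : (lam : ℂ) ≠ 0 := Complex.ofReal_ne_zero.mpr hlam.ne'
  have hzre : 0 ≤ (s / lam).re := by
    rw [Complex.div_ofReal_re]
    positivity
  have hpos := one_sub_div_one_sub_mul_re_pos hψ0 hψ1
    (re_one_sub_exp_neg_div_lt_one hzre (div_ne_zero hs hl))
  have hnum : s * ((s / lam + Complex.exp (-(s / lam)) - 1) / (s ^ 2 / lam)) =
      1 - (1 - Complex.exp (-(s / lam))) / (s / lam) := by
    generalize Complex.exp (-(s / lam)) = E
    field_simp
    ring
  rwa [← mul_assoc, hnum]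

/-- For `λᵢ > 0`, `ψᵢ ∈ [0,1)` and positive weights `a₁`, `a₂`, the combination
`a₁h₁(s) + a₂h₂(s)` of the tire transfer functions
`hᵢ(s) = ((s/λᵢ + exp(−s/λᵢ) − 1)/(s²/λᵢ)) · (1 − ψᵢ(1 − exp(−s/λᵢ))/(s/λᵢ))⁻¹`
has no zeros in the punctured closed right half-plane. -/
theorem stmt_8 (lam₁ lam₂ ψ₁ ψ₂ : ℝ) (hlam₁ : 0 < lam₁) (hlam₂ : 0 < lam₂)
    (hψ₁0 : 0 ≤ ψ₁) (hψ₁1 : ψ₁ < 1) (hψ₂0 : 0 ≤ ψ₂) (hψ₂1 : ψ₂ < 1)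
    (h₁ h₂ : ℂ → ℂ)
    (hdef₁ : ∀ s : ℂ, s ≠ 0 →
      h₁ s = ((s / lam₁ + Complex.exp (-(s / lam₁)) - 1) / (s ^ 2 / lam₁)) *
        (1 - (ψ₁ : ℂ) * ((1 - Complex.exp (-(s / lam₁))) / (s / lam₁)))⁻¹)
    (hdef₂ : ∀ s : ℂ, s ≠ 0 →
      h₂ s = ((s / lam₂ + Complex.exp (-(s / lam₂)) - 1) / (s ^ 2 / lam₂)) *
        (1 - (ψ₂ : ℂ) * ((1 - Complex.exp (-(s / lam₂))) / (s / lam₂)))⁻¹) :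
    ∀ (a₁ a₂ : ℝ), 0 < a₁ → 0 < a₂ →
      ∀ s : ℂ, 0 ≤ s.re → s ≠ 0 → (a₁ : ℂ) * h₁ s + (a₂ : ℂ) * h₂ s ≠ 0 := by
  intro a₁ a₂ ha₁ ha₂ s hre hs h
  have p₁ := mul_tire_transfer_re_pos hlam₁ hψ₁0 hψ₁1 hre hs
  have p₂ := mul_tire_transfer_re_pos hlam₂ hψ₂0 hψ₂1 hre hs
  rw [← hdef₁ s hs] at p₁
  rw [← hdef₂ s hs] at p₂
  have hsum : (a₁ : ℂ) * (s * h₁ s) + (a₂ : ℂ) * (s * h₂ s) = 0 := by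
    linear_combination s * h
  have hsum_re := congrArg Complex.re hsum
  rw [Complex.add_re, Complex.re_ofReal_mul, Complex.re_ofReal_mul, Complex.zero_re] at hsum_re
  linarith [mul_pos ha₁ p₁, mul_pos ha₂ p₂]
end
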